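/- Let V, V₁, V₂ be finite-dimensional real vector spaces, f₁ : V → V₁ and f₂ : V → V₂ linear maps, and x₁, x₂ seminorms on V₁ and V₂ respectively. Assume that for each i = 1, 2 there is a finite set Gᵢ of linear functionals on Vᵢ such that {w ∈ Vᵢ : xᵢ(w) ≤ 1} = {w ∈ Vᵢ : g(w) ≤ 1 for all g ∈ Gᵢ}. Then the seminorm x := x₁∘f₁ + x₂∘f₂ on V also has polyhedral unit ball: there exists a finite set G of linear functionals on V such that {v ∈ V : x(v) ≤ 1} = {v ∈ V : g(v) ≤ 1 for all g ∈ G}. -/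

import Mathlib

/-- A seminorm with polyhedral unit ball is the maximum of finitely many functionals. -/
theorem seminorm_max_aux {W : Type*} [AddCommGroup W] [Module ℝ W]
    (x : Seminorm ℝ W) (G : Set (W →ₗ[ℝ] ℝ)) (hfin : G.Finite)
    (hG : {w : W | x w ≤ 1} = {w : W | ∀ g ∈ G, g w ≤ 1}) (w : W) :
    (∀ g ∈ insert 0 G, g w ≤ x w) ∧ ∃ g ∈ insert 0 G, x w ≤ g w := by
  have key : ∀ c : ℝ, 0 < c → (x w ≤ c ↔ ∀ g ∈ G, g w ≤ c) := by
    intro c hc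
    have h := Set.ext_iff.mp hG (c⁻¹ • w)
    simp only [Set.mem_setOf_eq, map_smul, map_smul_eq_mul, smul_eq_mul, Real.norm_eq_abs,
      abs_of_pos (inv_pos.mpr hc), inv_mul_le_one₀ hc] at h
    exact h
  have hx0 : 0 ≤ x w := apply_nonneg x w
  constructor
  · intro g hg
    rcases Set.mem_insert_iff.mp hg with rfl | hg
    · simpa using hx0
    · refine le_of_forall_pos_le_add fun ε hε => ?_
      exact (key (x w + ε) (by linarith)).mp (by linarith) g hg
  · obtain ⟨g₀, hg₀, hmax⟩ := Set.exists_max_image (insert 0 G) (fun g : W →ₗ[ℝ] ℝ => g w)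
      (hfin.insert 0) ⟨0, Set.mem_insert _ _⟩
    refine ⟨g₀, hg₀, le_of_forall_pos_le_add fun ε hε => ?_⟩
    have h0 : 0 ≤ g₀ w := by simpa using hmax 0 (Set.mem_insert _ _)
    refine (key (g₀ w + ε) (by linarith)).mpr fun g hg => ?_
    have := hmax g (Set.mem_insert_of_mem _ hg)
    linarith

/-- If two seminorms on finite-dimensional real vector spaces have polyhedral unit
balls (finite intersections of half-spaces cut out by linear functionals), then the
sum of their pullbacks along linear maps also has polyhedral unit ball. -/
theorem seminorm_sum_pullback_polyhedral
    {V V₁ V₂ : Type*}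
    [AddCommGroup V] [Module ℝ V] [FiniteDimensional ℝ V]
    [AddCommGroup V₁] [Module ℝ V₁] [FiniteDimensional ℝ V₁]
    [AddCommGroup V₂] [Module ℝ V₂] [FiniteDimensional ℝ V₂]
    (f₁ : V →ₗ[ℝ] V₁) (f₂ : V →ₗ[ℝ] V₂)
    (x₁ : Seminorm ℝ V₁) (x₂ : Seminorm ℝ V₂)
    (G₁ : Set (V₁ →ₗ[ℝ] ℝ)) (hG₁fin : G₁.Finite)
    (hG₁ : {w : V₁ | x₁ w ≤ 1} = {w : V₁ | ∀ g ∈ G₁, g w ≤ 1})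
    (G₂ : Set (V₂ →ₗ[ℝ] ℝ)) (hG₂fin : G₂.Finite)
    (hG₂ : {w : V₂ | x₂ w ≤ 1} = {w : V₂ | ∀ g ∈ G₂, g w ≤ 1})
    (x : Seminorm ℝ V) (hx : ∀ v : V, x v = x₁ (f₁ v) + x₂ (f₂ v)) :
    ∃ G : Set (V →ₗ[ℝ] ℝ), G.Finite ∧
      {v : V | x v ≤ 1} = {v : V | ∀ g ∈ G, g v ≤ 1} := by
  refine ⟨Set.image2 (fun g₁ g₂ => g₁.comp f₁ + g₂.comp f₂) (insert 0 G₁) (insert 0 G₂),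
    (hG₁fin.insert 0).image2 _ (hG₂fin.insert 0), ?_⟩
  ext v
  obtain ⟨hle₁, g₁, hg₁, h₁⟩ := seminorm_max_aux x₁ G₁ hG₁fin hG₁ (f₁ v)
  obtain ⟨hle₂, g₂, hg₂, h₂⟩ := seminorm_max_aux x₂ G₂ hG₂fin hG₂ (f₂ v)
  simp only [Set.mem_setOf_eq, hx v]
  constructor
  · rintro h g ⟨k₁, hk₁, k₂, hk₂, rfl⟩
    have a := hle₁ k₁ hk₁
    have b := hle₂ k₂ hk₂
    simp only [LinearMap.add_apply, LinearMap.comp_apply]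
    linarith
  · intro h
    have a := h _ ⟨g₁, hg₁, g₂, hg₂, rfl⟩
    simp only [LinearMap.add_apply, LinearMap.comp_apply] at a
    linarith
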